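/- Completeness of LJ+ with respect to constrained Kripke structures: if a formula F is forced at every node of every constrained Kripke structure, then F is derivable in LJ+. -/

import Mathlib

/-! Syntax of first-order formulas. Atoms are either propositional symbols
(arity-0) or predicate symbols of arity ≥ 1 applied to variables.
There are no function symbols or object constants: terms are variables (ℕ). -/

inductive Formula : Type
  | prop : ℕ → Formula                      -- propositional symbol
  | pred : ℕ → ℕ → List ℕ → Formula         -- predicate symbol (arity ≥ 1) applied to variables
  | top : Formula
  | bot : Formula
  | and : Formula → Formula → Formula
  | or : Formula → Formula → Formula
  | imp : Formula → Formula → Formula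
  | neg : Formula → Formula
  | all : ℕ → Formula → Formula             -- ∀x A
  | ex : ℕ → Formula → Formula              -- ∃x A
  deriving DecidableEq

namespace Formula

/-- Free variables of a formula. -/
def fv : Formula → Finset ℕ
  | prop _ => ∅
  | pred _ x xs => insert x xs.toFinset
  | top => ∅
  | bot => ∅
  | and A B => fv A ∪ fv B
  | or A B => fv A ∪ fv B
  | imp A B => fv A ∪ fv B
  | neg A => fv A
  | all x A => (fv A).erase x
  | ex x A => (fv A).erase x

/-- All variables occurring in a formula (free or bound, including binders). -/
def vars : Formula → Finset ℕ
  | prop _ => ∅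
  | pred _ x xs => insert x xs.toFinset
  | top => ∅
  | bot => ∅
  | and A B => vars A ∪ vars B
  | or A B => vars A ∪ vars B
  | imp A B => vars A ∪ vars B
  | neg A => vars A
  | all x A => insert x (vars A)
  | ex x A => insert x (vars A)

/-- Binder variables of a formula. -/
def bv : Formula → Finset ℕ
  | prop _ => ∅
  | pred _ _ _ => ∅
  | top => ∅
  | bot => ∅
  | and A B => bv A ∪ bv B
  | or A B => bv A ∪ bv B
  | imp A B => bv A ∪ bv B
  | neg A => bv A
  | all x A => insert x (bv A)
  | ex x A => insert x (bv A)

/-- `rename a b F` replaces the free occurrences of variable `a` in `F` by variable `b`.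
`F.rename a b` plays the role of "F(b)" when `F` is "F(a)". -/
def rename (a b : ℕ) : Formula → Formula
  | prop n => prop n
  | pred n x xs =>
      pred n (if x = a then b else x) (xs.map fun y => if y = a then b else y)
  | top => top
  | bot => bot
  | and A B => and (rename a b A) (rename a b B)
  | or A B => or (rename a b A) (rename a b B)
  | imp A B => imp (rename a b A) (rename a b B)
  | neg A => neg (rename a b A)
  | all x A => if x = a then all x A else all x (rename a b A)
  | ex x A => if x = a then ex x A else ex x (rename a b A)

/-- A formula is propositional if it is built from propositional symbols (and ⊤, ⊥)
by the propositional connectives only. -/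
def Propositional : Formula → Prop
  | prop _ => True
  | pred _ _ _ => False
  | top => True
  | bot => True
  | and A B => Propositional A ∧ Propositional B
  | or A B => Propositional A ∧ Propositional B
  | imp A B => Propositional A ∧ Propositional B
  | neg A => Propositional A
  | all _ _ => False
  | ex _ _ => False

/-- A formula is purely predicate if all its atoms are built from predicate symbols
of arity > 0 (it contains no propositional symbols). -/
def PurelyPredicate : Formula → Prop
  | prop _ => False
  | pred _ _ _ => True
  | top => True
  | bot => True
  | and A B => PurelyPredicate A ∧ PurelyPredicate B
  | or A B => PurelyPredicate A ∧ PurelyPredicate B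
  | imp A B => PurelyPredicate A ∧ PurelyPredicate B
  | neg A => PurelyPredicate A
  | all _ A => PurelyPredicate A
  | ex _ A => PurelyPredicate A

/-- Truth-table evaluation of a propositional formula under assignment `v`. -/
def evalP (v : ℕ → Bool) : Formula → Bool
  | prop n => v n
  | pred _ _ _ => false
  | top => true
  | bot => false
  | and A B => evalP v A && evalP v B
  | or A B => evalP v A || evalP v B
  | imp A B => !evalP v A || evalP v B
  | neg A => !evalP v A
  | all _ _ => false
  | ex _ _ => false

/-- A (propositional) formula is classically valid / derivable in classical
propositional logic if it is true under every truth-value assignment. -/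
def ClassicallyValid (A : Formula) : Prop := ∀ v : ℕ → Bool, evalP v A = true

/-- `substProp R C A` replaces all occurrences of the propositional symbol `R`
in `A` by the formula `C` (written A{R|C} in the paper). -/
def substProp (R : ℕ) (C : Formula) : Formula → Formula
  | prop n => if n = R then C else prop n
  | pred n x xs => pred n x xs
  | top => top
  | bot => bot
  | and A B => and (substProp R C A) (substProp R C B)
  | or A B => or (substProp R C A) (substProp R C B)
  | imp A B => imp (substProp R C A) (substProp R C B)
  | neg A => neg (substProp R C A)
  | all x A => all x (substProp R C A)
  | ex x A => ex x (substProp R C A)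

/-- `polProps b F` is the set of propositional symbols having an occurrence of
polarity `b` in `F` (`true` = positive, `false` = negative); `F` itself is a
positive occurrence, ∨ & quantifiers preserve polarity, ¬ flips it, and
`A ⊃ B` flips the polarity of `A` and preserves that of `B`. -/
def polProps : Bool → Formula → Finset ℕ
  | b, prop n => if b then {n} else ∅
  | _, pred _ _ _ => ∅
  | _, top => ∅
  | _, bot => ∅
  | b, and A B => polProps b A ∪ polProps b B
  | b, or A B => polProps b A ∪ polProps b B
  | b, imp A B => polProps (!b) A ∪ polProps b B
  | b, neg A => polProps (!b) A
  | b, all _ A => polProps b A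
  | b, ex _ A => polProps b A

/-- The propositional symbols occurring in a formula. -/
def propSyms (F : Formula) : Finset ℕ := polProps true F ∪ polProps false F

/-- A formula is unipolar if the occurrences of every propositional symbol in it
are either all positive or all negative. -/
def Unipolar (F : Formula) : Prop :=
  ∀ n : ℕ, ¬ (n ∈ polProps true F ∧ n ∈ polProps false F)

end Formula

/-- A sequent Γ ⊢ Λ: the antecedent is a finite sequence of formulas and the
succedent contains at most one formula. -/
abbrev Sequent := List Formula × Option Formula

/-- Free variables of a list of formulas. -/
def fvList (Γ : List Formula) : Finset ℕ := Γ.foldr (fun A s => A.fv ∪ s) ∅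

/-- Free variables of an optional succedent formula. -/
def fvOpt : Option Formula → Finset ℕ
  | none => ∅
  | some A => A.fv

/-- Inference rules (conclusion, list of premises) of Gentzen-style sequent calculi.
The flag `cut` enables the cut rule, the flag `neut` enables the neutralization
rule (restricted to propositional formulas `N`), and `lem` determines the class of
formulas `A` for which the axiom `⊢ A ∨ ¬A` is available. -/
inductive Rule (cut neut : Bool) (lem : Formula → Prop) : Sequent → List Sequent → Prop
  | ax (A : Formula) : Rule cut neut lem ([A], some A) []
  | topR : Rule cut neut lem ([], some .top) []
  | botL : Rule cut neut lem ([.bot], none) []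
  | thinL (A : Formula) (Γ : List Formula) (Λ : Option Formula) :
      Rule cut neut lem (A :: Γ, Λ) [(Γ, Λ)]
  | thinR (A : Formula) (Γ : List Formula) :
      Rule cut neut lem (Γ, some A) [(Γ, none)]
  | contr (A : Formula) (Γ : List Formula) (Λ : Option Formula) :
      Rule cut neut lem (A :: Γ, Λ) [(A :: A :: Γ, Λ)]
  | exch (Δ Γ : List Formula) (A B : Formula) (Λ : Option Formula) :
      Rule cut neut lem (Δ ++ B :: A :: Γ, Λ) [(Δ ++ A :: B :: Γ, Λ)]
  | cut' (Γ Δ : List Formula) (C : Formula) (Λ : Option Formula) (hc : cut = true) :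
      Rule cut neut lem (Γ ++ Δ, Λ) [(Γ, some C), (C :: Δ, Λ)]
  | andR (Γ : List Formula) (A B : Formula) :
      Rule cut neut lem (Γ, some (A.and B)) [(Γ, some A), (Γ, some B)]
  | andL1 (A B : Formula) (Γ : List Formula) (Λ : Option Formula) :
      Rule cut neut lem (A.and B :: Γ, Λ) [(A :: Γ, Λ)]
  | andL2 (A B : Formula) (Γ : List Formula) (Λ : Option Formula) :
      Rule cut neut lem (A.and B :: Γ, Λ) [(B :: Γ, Λ)]
  | orL (A B : Formula) (Γ : List Formula) (Λ : Option Formula) :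
      Rule cut neut lem (A.or B :: Γ, Λ) [(A :: Γ, Λ), (B :: Γ, Λ)]
  | orR1 (Γ : List Formula) (A B : Formula) :
      Rule cut neut lem (Γ, some (A.or B)) [(Γ, some A)]
  | orR2 (Γ : List Formula) (A B : Formula) :
      Rule cut neut lem (Γ, some (A.or B)) [(Γ, some B)]
  | negR (A : Formula) (Γ : List Formula) :
      Rule cut neut lem (Γ, some A.neg) [(A :: Γ, none)]
  | negL (A : Formula) (Γ : List Formula) :
      Rule cut neut lem (A.neg :: Γ, none) [(Γ, some A)]
  | impR (A B : Formula) (Γ : List Formula) :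
      Rule cut neut lem (Γ, some (A.imp B)) [(A :: Γ, some B)]
  | impL (A B : Formula) (Γ Δ : List Formula) (Λ : Option Formula) :
      Rule cut neut lem (A.imp B :: (Γ ++ Δ), Λ) [(Γ, some A), (B :: Δ, Λ)]
  | allR (Γ : List Formula) (x a : ℕ) (G : Formula)
      (ha : a ∉ fvList Γ ∪ (Formula.all x G).fv) (hv : a ∉ G.vars) :
      Rule cut neut lem (Γ, some (.all x G)) [(Γ, some (G.rename x a))]
  | allL (x : ℕ) (G : Formula) (a : ℕ) (Γ : List Formula) (Λ : Option Formula)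
      (hc : a = x ∨ a ∉ G.bv) :
      Rule cut neut lem (.all x G :: Γ, Λ) [(G.rename x a :: Γ, Λ)]
  | exR (Γ : List Formula) (x : ℕ) (G : Formula) (a : ℕ)
      (hc : a = x ∨ a ∉ G.bv) :
      Rule cut neut lem (Γ, some (.ex x G)) [(Γ, some (G.rename x a))]
  | exL (x : ℕ) (G : Formula) (a : ℕ) (Γ : List Formula) (Λ : Option Formula)
      (ha : a ∉ (fvList Γ ∪ (Formula.ex x G).fv) ∪ fvOpt Λ) (hv : a ∉ G.vars) :
      Rule cut neut lem (.ex x G :: Γ, Λ) [(G.rename x a :: Γ, Λ)]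
  | neut' (N : Formula) (Γ : List Formula) (Λ : Option Formula)
      (hn : neut = true) (hN : N.Propositional) :
      Rule cut neut lem (Γ, Λ) [(N :: Γ, Λ), (N.neg :: Γ, Λ)]
  | lemAx (A : Formula) (h : lem A) :
      Rule cut neut lem ([], some (A.or A.neg)) []

/-- Derivability from a set of rules. -/
inductive Derives (R : Sequent → List Sequent → Prop) : Sequent → Prop
  | step {s : Sequent} {ps : List Sequent} :
      R s ps → (∀ p ∈ ps, Derives R p) → Derives R s

/-- No additional excluded-middle axioms. -/
def NoLem : Formula → Prop := fun _ => False

/-- LJ: Gentzen's intuitionistic sequent calculus. -/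
def LJ : Sequent → Prop := Derives (Rule true false NoLem)

/-- LJ+: LJ extended with the neutralization rule. -/
def LJPlus : Sequent → Prop := Derives (Rule true true NoLem)

/-- Cut-free LJ+. -/
def LJPlusCF : Sequent → Prop := Derives (Rule false true NoLem)

/-- LJ extended with the axiom schema ⊢ A ∨ ¬A for every propositional symbol A. -/
def LJLemPropAtoms : Sequent → Prop :=
  Derives (Rule true false (fun A => ∃ n : ℕ, A = Formula.prop n))

/-- LK: Gentzen's classical sequent calculus, presented equivalently as
LJ plus the axiom schema ⊢ A ∨ ¬A for arbitrary formulas A. -/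
def LK : Sequent → Prop := Derives (Rule true false (fun _ => True))

/-- A formula is a theorem of LJ+ if the sequent ⊢ F is derivable. -/
def LJPlusThm (F : Formula) : Prop := LJPlus ([], some F)

def LJThm (F : Formula) : Prop := LJ ([], some F)

def LKThm (F : Formula) : Prop := LK ([], some F)

/-- Intuitionistic Kripke structures: a partially ordered set of nodes with
monotone nonempty domains and monotone valuations for propositional symbols
and for predicate symbols. -/
structure Kripke where
  W : Type
  U : Type
  le : W → W → Prop
  le_refl : ∀ w, le w w
  le_trans : ∀ u v w, le u v → le v w → le u w
  le_antisymm : ∀ u v, le u v → le v u → u = v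
  D : W → Set U
  D_ne : ∀ w, (D w).Nonempty
  D_mono : ∀ {w w'}, le w w' → D w ⊆ D w'
  TP : W → ℕ → Prop
  TQ : W → ℕ → List U → Prop
  TP_mono : ∀ {w w'}, le w w' → ∀ n, TP w n → TP w' n
  TQ_mono : ∀ {w w'}, le w w' → ∀ n ds, TQ w n ds → TQ w' n ds

/-- A constrained Kripke structure: for all nodes k ≤ k' and every propositional
symbol Q, Q is in the valuation of k if and only if it is in the valuation of k'. -/
def Kripke.Constrained (K : Kripke) : Prop :=
  ∀ {w w' : K.W}, K.le w w' → ∀ n : ℕ, (K.TP w n ↔ K.TP w' n)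

/-- The standard intuitionistic forcing relation (with an assignment σ of
domain elements to variables). -/
def Kripke.forces (K : Kripke) : K.W → (ℕ → K.U) → Formula → Prop
  | w, _, .prop n => K.TP w n
  | w, σ, .pred n x xs => K.TQ w n ((x :: xs).map σ)
  | _, _, .top => True
  | _, _, .bot => False
  | w, σ, .and A B => K.forces w σ A ∧ K.forces w σ B
  | w, σ, .or A B => K.forces w σ A ∨ K.forces w σ B
  | w, σ, .imp A B => ∀ w', K.le w w' → K.forces w' σ A → K.forces w' σ B
  | w, σ, .neg A => ∀ w', K.le w w' → ¬ K.forces w' σ A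
  | w, σ, .all x A => ∀ w', K.le w w' → ∀ d ∈ K.D w', K.forces w' (Function.update σ x d) A
  | w, σ, .ex x A => ∃ d ∈ K.D w, K.forces w (Function.update σ x d) A

/-- Validity of a sequent with respect to constrained Kripke structures:
at every node of every constrained Kripke structure (under every assignment into
the node's domain), either some antecedent formula is not forced, or the
succedent is nonempty and its formula is forced. -/
def SeqValid (s : Sequent) : Prop :=
  ∀ K : Kripke, K.Constrained → ∀ w : K.W, ∀ σ : ℕ → K.U, (∀ n, σ n ∈ K.D w) →
    (∃ A ∈ s.1, ¬ K.forces w σ A) ∨ (∃ A, s.2 = some A ∧ K.forces w σ A)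

namespace Formula

/-- A Gödel numbering of formulas. -/
def godelNumber : Formula → ℕ
  | prop n => Nat.pair 0 n
  | pred n x xs => Nat.pair 1 (Nat.pair n (Nat.pair x (Encodable.encode xs)))
  | top => Nat.pair 2 0
  | bot => Nat.pair 3 0
  | and A B => Nat.pair 4 (Nat.pair (godelNumber A) (godelNumber B))
  | or A B => Nat.pair 5 (Nat.pair (godelNumber A) (godelNumber B))
  | imp A B => Nat.pair 6 (Nat.pair (godelNumber A) (godelNumber B))
  | neg A => Nat.pair 7 (godelNumber A)
  | all x A => Nat.pair 8 (Nat.pair x (godelNumber A))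
  | ex x A => Nat.pair 9 (Nat.pair x (godelNumber A))

lemma godelNumber_injective : Function.Injective godelNumber := by
  intro A
  induction A <;> rintro (_ | _ | _ | _ | _ | _ | _ | _ | _ | _) h <;>
    simp [godelNumber, Nat.pair_eq_pair] at h ⊢ <;> grind

instance : Countable Formula := godelNumber_injective.countable

/-- Simultaneous substitution of the free variables of a formula (not capture-avoiding). -/
def subst : (ℕ → ℕ) → Formula → Formula
  | _, prop n => prop n
  | σ, pred n x xs => pred n (σ x) (xs.map σ)
  | _, top => top
  | _, bot => bot
  | σ, and A B => and (subst σ A) (subst σ B)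
  | σ, or A B => or (subst σ A) (subst σ B)
  | σ, imp A B => imp (subst σ A) (subst σ B)
  | σ, neg A => neg (subst σ A)
  | σ, all x A => all x (subst (Function.update σ x x) A)
  | σ, ex x A => ex x (subst (Function.update σ x x) A)

lemma subst_id (A : Formula) : subst id A = A := by
  have hu : ∀ x : ℕ, Function.update (id : ℕ → ℕ) x x = id := fun x =>
    Function.update_eq_self x id
  induction A <;> simp_all only [subst, List.map_id, id]

lemma subst_congr {A : Formula} {σ τ : ℕ → ℕ} (h : ∀ x ∈ A.fv, σ x = τ x) :
    subst σ A = subst τ A := by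
  induction A generalizing σ τ with
  | prop | top | bot => rfl
  | pred n x xs =>
    simp only [fv, Finset.mem_insert, List.mem_toFinset, forall_eq_or_imp] at h
    simp only [subst, h.1, List.map_congr_left h.2]
  | and A B ihA ihB | or A B ihA ihB | imp A B ihA ihB =>
    simp only [fv, Finset.mem_union] at h
    simp only [subst, ihA fun x hx => h x (.inl hx), ihB fun x hx => h x (.inr hx)]
  | neg A ih => simp only [subst, ih h]
  | all x A ih | ex x A ih =>
    simp only [subst]
    rw [ih fun y hy => ?_]
    by_cases hyx : y = x
    · simp [hyx]
    · simpa [hyx] using h y (Finset.mem_erase.2 ⟨hyx, hy⟩)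

lemma bv_subst (A : Formula) (σ : ℕ → ℕ) : (subst σ A).bv = A.bv := by
  induction A generalizing σ <;> simp_all [subst, bv]

lemma vars_eq (A : Formula) : A.vars = A.fv ∪ A.bv := by
  induction A <;> ext y <;> simp_all [vars, fv, bv] <;> grind

lemma mem_fv_subst {A : Formula} {σ : ℕ → ℕ} {y : ℕ} (h : y ∈ (subst σ A).fv) :
    ∃ x ∈ A.fv, σ x = y := by
  induction A generalizing σ with
  | prop | top | bot => simp [subst, fv] at h
  | pred n x xs =>
    simp only [subst, fv, Finset.mem_insert, List.mem_toFinset, List.mem_map] at h ⊢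
    grind
  | and A B ihA ihB | or A B ihA ihB | imp A B ihA ihB =>
    simp only [subst, fv, Finset.mem_union] at h ⊢
    grind
  | neg A ih => exact ih h
  | all x A ih | ex x A ih =>
    simp only [subst, fv, Finset.mem_erase] at h ⊢
    obtain ⟨z, hz, e⟩ := ih h.2
    by_cases hzx : z = x
    · subst hzx
      simp only [Function.update_self] at e
      exact absurd e.symm h.1
    · rw [Function.update_of_ne hzx] at e
      exact ⟨z, ⟨hzx, hz⟩, e⟩

lemma mem_fv_rename {A : Formula} {x a y : ℕ} (h : y ∈ (A.rename x a).fv) :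
    y = a ∨ (y ∈ A.fv ∧ y ≠ x) := by
  induction A with
  | prop | top | bot => simp [rename, fv] at h
  | pred n z zs =>
    simp only [rename, fv, Finset.mem_insert, List.mem_toFinset, List.mem_map] at h ⊢
    grind
  | and A B ihA ihB | or A B ihA ihB | imp A B ihA ihB =>
    simp only [rename, fv, Finset.mem_union] at h ⊢
    grind
  | neg A ih => exact ih h
  | all z A ih | ex z A ih =>
    simp only [rename] at h
    split_ifs at h <;> simp only [fv, Finset.mem_erase] at h ⊢ <;> grind

lemma rename_subst (A : Formula) {σ : ℕ → ℕ} {x : ℕ} (a : ℕ) (h : ∀ z, z ≠ x → σ z ≠ x) :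
    (subst (Function.update σ x x) A).rename x a = subst (Function.update σ x a) A := by
  have hvar : ∀ z, (if Function.update σ x x z = x then a else Function.update σ x x z) =
      Function.update σ x a z := by
    intro z
    by_cases hz : z = x
    · simp [hz]
    · simp [hz, h z hz]
  induction A generalizing σ with
  | prop | top | bot => rfl
  | pred n z zs =>
    simp only [subst, rename, hvar, List.map_map]
    congr 2
    exact funext hvar
  | and A B ihA ihB | or A B ihA ihB | imp A B ihA ihB =>
    simp only [subst, rename, ihA h hvar, ihB h hvar]
  | neg A ih => simp only [subst, rename, ih h hvar]
  | all z A ih | ex z A ih =>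
    simp only [subst, rename]
    split_ifs with hz
    · subst hz
      simp
    · have h' : ∀ u, u ≠ x → Function.update σ z z u ≠ x := by
        intro u hu
        by_cases huz : u = z
        · simpa [huz] using hz
        · simpa [huz] using h u hu
      rw [Function.update_comm (Ne.symm hz), Function.update_comm (Ne.symm hz), ih h']
      intro u
      by_cases hu : u = x
      · simp [hu]
      · simp [hu, h' u hu]

end Formula

lemma mem_fvList {a : ℕ} {Γ : List Formula} : a ∈ fvList Γ ↔ ∃ A ∈ Γ, a ∈ A.fv := by
  induction Γ with
  | nil => simp [fvList]
  | cons A Γ ih =>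
    rw [show fvList (A :: Γ) = A.fv ∪ fvList Γ from rfl]
    simp [ih]

namespace LJPlus

lemma of_rule₀ {s : Sequent} (h : Rule true true NoLem s []) : LJPlus s :=
  .step h (by simp)

lemma of_rule₁ {s p : Sequent} (h : Rule true true NoLem s [p]) (hp : LJPlus p) : LJPlus s :=
  .step h (List.forall_mem_singleton.2 hp)

lemma of_rule₂ {s p q : Sequent} (h : Rule true true NoLem s [p, q]) (hp : LJPlus p)
    (hq : LJPlus q) : LJPlus s :=
  .step h (by simpa using ⟨hp, hq⟩)

lemma perm {Γ Γ' : List Formula} {Λ : Option Formula} (h : Γ.Perm Γ') (d : LJPlus (Γ, Λ)) :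
    LJPlus (Γ', Λ) := by
  suffices H : ∀ Δ, LJPlus (Δ ++ Γ, Λ) → LJPlus (Δ ++ Γ', Λ) from H [] d
  clear d
  induction h with
  | nil => exact fun _ d => d
  | cons a _ ih =>
    intro Δ d
    simpa using ih (Δ ++ [a]) (by simpa using d)
  | swap a b l => exact fun Δ d => of_rule₁ (.exch Δ l b a Λ) d
  | trans _ _ ih₁ ih₂ => exact fun Δ d => ih₂ Δ (ih₁ Δ d)

lemma weaken_append {Γ : List Formula} {Λ : Option Formula} (Δ : List Formula)
    (d : LJPlus (Γ, Λ)) : LJPlus (Δ ++ Γ, Λ) := by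
  induction Δ with
  | nil => exact d
  | cons A Δ ih => exact of_rule₁ (.thinL A (Δ ++ Γ) Λ) ih

lemma absorb {Γ Γ' : List Formula} {Λ : Option Formula} (h : Γ ⊆ Γ')
    (d : LJPlus (Γ ++ Γ', Λ)) : LJPlus (Γ', Λ) := by
  induction Γ with
  | nil => exact d
  | cons A Γ ih =>
    rw [List.cons_subset] at h
    have hp : (Γ ++ Γ').Perm (A :: (Γ ++ Γ'.erase A)) :=
      ((List.perm_cons_erase h.1).append_left Γ).trans List.perm_middle
    exact ih h.2 (perm hp.symm (of_rule₁ (.contr A _ Λ) (perm (hp.cons A) d)))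

lemma mono {Γ Γ' : List Formula} {Λ : Option Formula} (h : Γ ⊆ Γ') (d : LJPlus (Γ, Λ)) :
    LJPlus (Γ', Λ) :=
  absorb h (perm List.perm_append_comm (weaken_append Γ' d))

lemma of_bot {Γ : List Formula} (Λ : Option Formula) (d : LJPlus (Γ, some .bot)) :
    LJPlus (Γ, Λ) := by
  have hb : LJPlus ([.bot], Λ) := by
    cases Λ with
    | none => exact of_rule₀ .botL
    | some A => exact of_rule₁ (.thinR A _) (of_rule₀ .botL)
  simpa using of_rule₂ (.cut' Γ [] .bot Λ rfl) d hb

/-- Generalization over a fresh variable followed by instantiation with the original one. -/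
lemma of_rename {A : Formula} {x a : ℕ} (ha : a ∉ A.vars)
    (d : LJPlus ([], some (A.rename x a))) : LJPlus ([], some A) := by
  have hfv : a ∉ A.fv := fun h => ha (by simp [Formula.vars_eq, h])
  have hall : LJPlus ([], some (.all x A)) :=
    of_rule₁ (.allR [] x a A (by simp [fvList, Formula.fv, hfv]) ha) d
  have hid : A.rename x x = A := by
    clear ha d hfv hall
    induction A with
    | pred n z zs =>
      have h : ∀ y, (if y = x then x else y) = y := by intro y; split_ifs <;> simp_all
      simp [Formula.rename, h]
    | _ => simp_all [Formula.rename]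
  have hinst : LJPlus ([.all x A], some A) :=
    of_rule₁ (.allL x A x [] (some A) (.inl rfl)) (by rw [hid]; exact of_rule₀ (.ax A))
  exact of_rule₂ (.cut' [] [] (.all x A) (some A) rfl) hall hinst

end LJPlus

/-- Derivability in LJ+ from a set of hypotheses. -/
def Prov (S : Set Formula) (A : Formula) : Prop :=
  ∃ Γ : List Formula, (∀ B ∈ Γ, B ∈ S) ∧ LJPlus (Γ, some A)

namespace Prov

variable {S S' : Set Formula} {A B C : Formula}

lemma hyp (h : A ∈ S) : Prov S A := ⟨[A], by simpa using h, .of_rule₀ (.ax A)⟩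

lemma mono (h : S ⊆ S') : Prov S A → Prov S' A := fun ⟨Γ, hΓ, d⟩ =>
  ⟨Γ, fun B hB => h (hΓ B hB), d⟩

lemma exists_cons (h : Prov (insert A S) B) :
    ∃ Γ : List Formula, (∀ C ∈ Γ, C ∈ S) ∧ LJPlus (A :: Γ, some B) := by
  obtain ⟨Γ, hΓ, d⟩ := h
  refine ⟨Γ.filter (· ≠ A), fun C hC => ?_, d.mono fun C hC => ?_⟩
  · simp only [ne_eq, decide_not, List.mem_filter, Bool.not_eq_eq_eq_not, Bool.not_true,
      decide_eq_false_iff_not] at hC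
    exact (hΓ C hC.1).resolve_left hC.2
  · by_cases h : C = A <;> simp [h, hC]

lemma imp_intro (h : Prov (insert A S) B) : Prov S (A.imp B) := by
  obtain ⟨Γ, hΓ, d⟩ := h.exists_cons
  exact ⟨Γ, hΓ, .of_rule₁ (.impR A B Γ) d⟩

lemma neg_intro (h : Prov (insert A S) .bot) : Prov S A.neg := by
  obtain ⟨Γ, hΓ, d⟩ := h.exists_cons
  exact ⟨Γ, hΓ, .of_rule₁ (.negR A Γ) (d.of_bot none)⟩

lemma mp (h : Prov S (A.imp B)) (h' : Prov S A) : Prov S B := by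
  obtain ⟨Γ, hΓ, d⟩ := h
  obtain ⟨Γ', hΓ', d'⟩ := h'
  refine ⟨Γ ++ (Γ' ++ []), by simpa [or_imp, forall_and] using ⟨hΓ, hΓ'⟩, ?_⟩
  exact .of_rule₂ (.cut' Γ (Γ' ++ []) (A.imp B) (some B) rfl) d
    (.of_rule₂ (.impL A B Γ' [] (some B)) d' (.of_rule₀ (.ax B)))

lemma of_sequent {Δ : List Formula} (d : LJPlus (Δ, some B)) (h : ∀ A ∈ Δ, Prov S A) :
    Prov S B := by
  induction Δ generalizing B with
  | nil => exact ⟨[], by simp, d⟩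
  | cons A Δ ih =>
    simp only [List.mem_cons, forall_eq_or_imp] at h
    exact (ih (.of_rule₁ (.impR A B Δ) d) h.2).mp h.1

lemma of_sequent₁ (d : LJPlus ([A], some B)) (h : Prov S A) : Prov S B :=
  of_sequent d (by simpa using h)

lemma cut (h : Prov S A) (h' : Prov (insert A S) B) : Prov S B := h'.imp_intro.mp h

lemma bot_elim (h : Prov S .bot) : Prov S A :=
  h.of_sequent₁ (LJPlus.of_bot _ (.of_rule₀ (.ax _)))

lemma top_intro : Prov S .top := of_sequent (.of_rule₀ .topR) (by simp)

lemma neg_elim (h : Prov S A.neg) (h' : Prov S A) : Prov S .bot :=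
  of_sequent (Δ := [A.neg, A])
    (.of_rule₁ (.thinR .bot _) (.of_rule₁ (.negL A [A]) (.of_rule₀ (.ax A))))
    (by simpa using ⟨h, h'⟩)

lemma and_intro (h : Prov S A) (h' : Prov S B) : Prov S (A.and B) :=
  of_sequent (Δ := [A, B])
    (.of_rule₂ (.andR _ A B) (LJPlus.mono (by simp) (.of_rule₀ (.ax A)))
      (LJPlus.mono (by simp) (.of_rule₀ (.ax B)))) (by simpa using ⟨h, h'⟩)

lemma and_left (h : Prov S (A.and B)) : Prov S A :=
  h.of_sequent₁ (.of_rule₁ (.andL1 A B [] _) (.of_rule₀ (.ax A)))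

lemma and_right (h : Prov S (A.and B)) : Prov S B :=
  h.of_sequent₁ (.of_rule₁ (.andL2 A B [] _) (.of_rule₀ (.ax B)))

lemma or_inl (h : Prov S A) : Prov S (A.or B) :=
  h.of_sequent₁ (.of_rule₁ (.orR1 _ A B) (.of_rule₀ (.ax A)))

lemma or_inr (h : Prov S B) : Prov S (A.or B) :=
  h.of_sequent₁ (.of_rule₁ (.orR2 _ A B) (.of_rule₀ (.ax B)))

lemma or_elim (h : Prov S (A.or B)) (hA : Prov (insert A S) C) (hB : Prov (insert B S) C) :
    Prov S C := by
  refine of_sequent (Δ := [A.or B, A.imp C, B.imp C]) (.of_rule₂ (.orL A B _ _) ?_ ?_)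
    (by simpa using ⟨h, hA.imp_intro, hB.imp_intro⟩)
  · exact LJPlus.mono (Γ := A.imp C :: ([A] ++ [])) (by simp)
      (.of_rule₂ (.impL A C [A] [] _) (.of_rule₀ (.ax A)) (.of_rule₀ (.ax C)))
  · exact LJPlus.mono (Γ := B.imp C :: ([B] ++ [])) (by simp)
      (.of_rule₂ (.impL B C [B] [] _) (.of_rule₀ (.ax B)) (.of_rule₀ (.ax C)))

lemma prop_em (n : ℕ) : Prov S ((Formula.prop n).or (Formula.prop n).neg) :=
  of_sequent (.of_rule₂ (.neut' (.prop n) [] _ rfl trivial)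
    (.of_rule₁ (.orR1 _ _ _) (.of_rule₀ (.ax _)))
    (.of_rule₁ (.orR2 _ _ _) (.of_rule₀ (.ax _)))) (by simp)

lemma all_elim {x a : ℕ} (ha : a ∉ A.bv) (h : Prov S (.all x A)) : Prov S (A.rename x a) :=
  h.of_sequent₁ (.of_rule₁ (.allL x A a [] _ (.inr ha)) (.of_rule₀ (.ax _)))

lemma ex_intro {x a : ℕ} (ha : a ∉ A.bv) (h : Prov S (A.rename x a)) : Prov S (.ex x A) :=
  h.of_sequent₁ (.of_rule₁ (.exR _ x A a (.inr ha)) (.of_rule₀ (.ax _)))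

lemma all_intro {x a : ℕ} (hS : ∀ B ∈ S, a ∉ B.fv) (ha : a ∉ A.vars)
    (h : Prov S (A.rename x a)) : Prov S (.all x A) := by
  obtain ⟨Γ, hΓ, d⟩ := h
  refine ⟨Γ, hΓ, .of_rule₁ (.allR Γ x a A ?_ ha) d⟩
  rw [Formula.vars_eq] at ha
  simp only [Finset.mem_union, mem_fvList, Formula.fv, Finset.mem_erase] at ha ⊢
  grind

lemma ex_elim {x a : ℕ} (hS : ∀ B ∈ S, a ∉ B.fv) (ha : a ∉ A.vars) (hC : a ∉ C.fv)
    (h : Prov S (.ex x A)) (h' : Prov (insert (A.rename x a) S) C) : Prov S C := by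
  obtain ⟨Γ, hΓ, d⟩ := h'.exists_cons
  refine h.cut ⟨.ex x A :: Γ, by simp; grind, .of_rule₁ (.exL x A a Γ _ ?_ ha) d⟩
  rw [Formula.vars_eq] at ha
  simp only [Finset.mem_union, mem_fvList, Formula.fv, Finset.mem_erase, fvOpt] at ha ⊢
  grind

lemma exists_of_iUnion {f : ℕ → Set Formula} (hf : Monotone f) (h : Prov (⋃ n, f n) A) :
    ∃ n, Prov (f n) A := by
  obtain ⟨Γ, hΓ, d⟩ := h
  have : ∃ n, ∀ B ∈ Γ, B ∈ f n := by
    clear d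
    induction Γ with
    | nil => simp
    | cons B Γ ih =>
      simp only [List.mem_cons, forall_eq_or_imp] at hΓ ⊢
      obtain ⟨n, hn⟩ := ih hΓ.2
      obtain ⟨m, hm⟩ := Set.mem_iUnion.1 hΓ.1
      exact ⟨max n m, hf (le_max_right n m) hm, fun C hC => hf (le_max_left n m) (hn C hC)⟩
  obtain ⟨n, hn⟩ := this
  exact ⟨n, Γ, hn, d⟩

end Prov

/-- The parameters of level `k`: the variables `≥ N` whose first `Nat.unpair` component is
at most `k`. Each level adds infinitely many parameters. -/
def params (N k : ℕ) : Set ℕ := {n | N ≤ n ∧ n.unpair.1 ≤ k}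

lemma params_mono (N : ℕ) : Monotone (params N) := fun _ _ h _ hn => ⟨hn.1, hn.2.trans h⟩

lemma exists_fresh_param (N k : ℕ) (s : Finset ℕ) :
    ∃ a ∈ params N (k + 1), a ∉ params N k ∧ a ∉ s := by
  have hle := Nat.right_le_pair (k + 1) (N + s.sup id + 1)
  refine ⟨Nat.pair (k + 1) (N + s.sup id + 1), ⟨by omega, by simp⟩, fun h => ?_, fun h => ?_⟩
  · simpa using h.2
  · have := Finset.le_sup (f := id) h
    simp only [id] at this
    omega

/-- The formulas with free variables among the parameters of level `k`. -/
def lang (N k : ℕ) : Set Formula := {A | ∀ y ∈ A.fv, y ∈ params N k}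

lemma lang_mono (N : ℕ) : Monotone (lang N) := fun _ _ h _ hA y hy => params_mono N h (hA y hy)

lemma rename_mem_lang {N k x a : ℕ} {A : Formula} (ha : a ∈ params N k)
    (hA : ∀ y ∈ A.fv, y ≠ x → y ∈ params N k) : A.rename x a ∈ lang N k := by
  intro y hy
  rcases Formula.mem_fv_rename hy with rfl | ⟨h, hne⟩
  exacts [ha, hA y h hne]

lemma subst_mem_lang {N k : ℕ} {σ : ℕ → ℕ} (hσ : ∀ n, σ n ∈ params N k) (A : Formula) :
    A.subst σ ∈ lang N k := by
  intro y hy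
  obtain ⟨x, -, rfl⟩ := Formula.mem_fv_subst hy
  exact hσ x

/-- Consistent prime theories of some level with parameters witnessing existential formulas. -/
@[ext]
structure PrimeTheory (N : ℕ) where
  level : ℕ
  carrier : Set Formula
  subset_lang : carrier ⊆ lang N level
  consistent : ¬ Prov carrier .bot
  closed : ∀ {A}, Prov carrier A → A ∈ lang N level → A ∈ carrier
  prime : ∀ {A B}, Formula.or A B ∈ carrier → A ∈ carrier ∨ B ∈ carrier
  witness : ∀ {x A}, Formula.ex x A ∈ carrier → ∃ a ∈ params N level, A.rename x a ∈ carrier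

/-- The stages in the construction of a prime theory of level `k + 1` extending `S` and
avoiding `G`. -/
structure IsStage (N k : ℕ) (S : Set Formula) (G : Formula) (X : Set Formula) : Prop where
  finite_diff : (X \ S).Finite
  subset_lang : X ⊆ lang N (k + 1)
  not_prov : ¬ Prov X G

section Lindenbaum

variable {N k : ℕ} {S X : Set Formula} {G : Formula}

lemma IsStage.exists_fresh (hS : S ⊆ lang N k) (hX : IsStage N k S G X) (A : Formula) :
    ∃ a ∈ params N (k + 1), (∀ B ∈ X, a ∉ B.fv) ∧ a ∉ A.vars ∧ a ∉ G.fv := by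
  obtain ⟨a, ha, hak, has⟩ := exists_fresh_param N k
    (hX.finite_diff.toFinset.biUnion Formula.fv ∪ A.vars ∪ G.fv)
  simp only [Finset.mem_union, Finset.mem_biUnion, Set.Finite.mem_toFinset, not_or] at has
  refine ⟨a, ha, fun B hB haB => ?_, has.1.2, has.2⟩
  by_cases hBS : B ∈ S
  · exact hak (hS hBS a haB)
  · exact has.1.1 ⟨B, ⟨hB, hBS⟩, haB⟩

lemma IsStage.insert (hX : IsStage N k S G X) {A : Formula} (hA : A ∈ lang N (k + 1))
    (h : ¬ Prov (insert A X) G) : IsStage N k S G (insert A X) where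
  finite_diff := (hX.finite_diff.insert A).subset fun B hB => by
    rcases hB with ⟨rfl | hB, hBS⟩
    exacts [Or.inl rfl, Or.inr ⟨hB, hBS⟩]
  subset_lang := Set.insert_subset hA hX.subset_lang
  not_prov := h

lemma IsStage.exists_step (hS : S ⊆ lang N k) (hX : IsStage N k S G X) (A : Formula) :
    ∃ Y, IsStage N k S G Y ∧ X ⊆ Y ∧ (A ∈ lang N (k + 1) → ¬ Prov (Insert.insert A X) G →
      A ∈ Y ∧ ∀ x B, A = .ex x B → ∃ a ∈ params N (k + 1), B.rename x a ∈ Y) := by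
  by_cases hA : A ∈ lang N (k + 1) ∧ ¬ Prov (Insert.insert A X) G
  swap
  · exact ⟨X, hX, subset_rfl, fun h h' => absurd ⟨h, h'⟩ hA⟩
  have hX' := hX.insert hA.1 hA.2
  by_cases hex : ∃ x B, A = .ex x B
  · obtain ⟨x, B, rfl⟩ := hex
    obtain ⟨a, ha, haX, haB, haG⟩ := hX'.exists_fresh hS B
    refine ⟨_, hX'.insert (A := B.rename x a) (rename_mem_lang ha fun y hy hne => ?_) fun h => ?_,
      (Set.subset_insert _ _).trans (Set.subset_insert _ _), fun _ _ => ⟨by simp, ?_⟩⟩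
    · exact hA.1 y (by simp [Formula.fv, hy, hne])
    · exact hA.2 (Prov.ex_elim haX haB haG (.hyp (by simp)) h)
    · rintro _ _ ⟨⟩
      exact ⟨a, ha, by simp⟩
  · exact ⟨_, hX', Set.subset_insert _ _, fun _ _ => ⟨by simp, fun x B h => absurd ⟨x, B, h⟩ hex⟩⟩

/-- Lindenbaum's lemma: an unprovable formula is avoided by a prime theory of the next level. -/
lemma exists_primeTheory (hS : S ⊆ lang N k) (h : ¬ Prov S G) :
    ∃ T : PrimeTheory N, T.level = k + 1 ∧ S ⊆ T.carrier ∧ G ∉ T.carrier := by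
  have : Nonempty Formula := ⟨.top⟩
  obtain ⟨e, he⟩ := exists_surjective_nat Formula
  choose! next hstage hsub hnext using
    fun (A : Formula) (X : Set Formula) (hX : IsStage N k S G X) => hX.exists_step hS A
  let f : ℕ → Set Formula := fun n => Nat.rec S (fun n X => next (e n) X) n
  have hf : ∀ n, IsStage N k S G (f n) := by
    intro n
    induction n with
    | zero => exact ⟨by simp [f], hS.trans (lang_mono N k.le_succ), h⟩
    | succ n ih => exact hstage _ _ ih
  have hmono : Monotone f := monotone_nat_of_le_succ fun n => hsub _ _ (hf n)
  have hT : ¬ Prov (⋃ n, f n) G := fun hp =>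
    (Prov.exists_of_iUnion hmono hp).elim fun n => (hf n).not_prov
  have hmax : ∀ A ∈ lang N (k + 1), ¬ Prov (insert A (⋃ n, f n)) G → A ∈ (⋃ n, f n) ∧
      ∀ x B, A = .ex x B → ∃ a ∈ params N (k + 1), B.rename x a ∈ ⋃ n, f n := by
    intro A hA hp
    obtain ⟨n, rfl⟩ := he A
    obtain ⟨h₁, h₂⟩ := hnext (e n) (f n) (hf n) hA fun h =>
      hp (h.mono (Set.insert_subset_insert (Set.subset_iUnion f n)))
    have hs : next (e n) (f n) ⊆ ⋃ n, f n := Set.subset_iUnion f (n + 1)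
    refine ⟨hs h₁, fun x B hB => ?_⟩
    obtain ⟨a, ha, hm⟩ := h₂ x B hB
    exact ⟨a, ha, hs hm⟩
  have hlang : (⋃ n, f n) ⊆ lang N (k + 1) := Set.iUnion_subset fun n => (hf n).subset_lang
  refine ⟨⟨k + 1, ⋃ n, f n, hlang, fun h => hT h.bot_elim, fun hp hA => ?_, fun {A B} hAB => ?_,
    fun {x A} hex => ?_⟩, rfl, Set.subset_iUnion f 0, fun hp => hT (.hyp hp)⟩
  · exact (hmax _ hA fun h => hT (hp.cut h)).1
  · by_contra! hn
    have hl := hlang hAB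
    have hA : A ∈ lang N (k + 1) := fun y hy => hl y (by simp [Formula.fv, hy])
    have hB : B ∈ lang N (k + 1) := fun y hy => hl y (by simp [Formula.fv, hy])
    have hpA : Prov (insert A (⋃ n, f n)) G := by
      by_contra hp
      exact hn.1 (hmax A hA hp).1
    have hpB : Prov (insert B (⋃ n, f n)) G := by
      by_contra hp
      exact hn.2 (hmax B hB hp).1
    exact hT (.or_elim (.hyp hAB) hpA hpB)
  · exact (hmax _ (hlang hex) (by rwa [Set.insert_eq_of_mem hex])).2 x A rfl

end Lindenbaum

/-- The Kripke structure of prime theories, ordered by inclusion. -/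
def canonicalKripke (N : ℕ) : Kripke where
  W := PrimeTheory N
  U := ℕ
  le T T' := T.level ≤ T'.level ∧ T.carrier ⊆ T'.carrier
  le_refl _ := ⟨le_rfl, subset_rfl⟩
  le_trans _ _ _ h h' := ⟨h.1.trans h'.1, h.2.trans h'.2⟩
  le_antisymm _ _ h h' := PrimeTheory.ext (h.1.antisymm h'.1) (h.2.antisymm h'.2)
  D T := params N T.level
  D_ne T := ⟨Nat.pair 0 N, Nat.right_le_pair 0 N, by simp⟩
  D_mono h := params_mono N h.1
  TP T n := .prop n ∈ T.carrier
  TQ T n ds := ∃ x xs, ds = x :: xs ∧ .pred n x xs ∈ T.carrier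
  TP_mono h _ hn := h.2 hn
  TQ_mono h _ _ := fun ⟨x, xs, hd, hm⟩ => ⟨x, xs, hd, h.2 hm⟩

lemma canonicalKripke_constrained (N : ℕ) : (canonicalKripke N).Constrained := by
  intro (T : PrimeTheory N) (T' : PrimeTheory N) hle n
  refine ⟨fun h => hle.2 h, fun h => ?_⟩
  refine (T.prime (T.closed (.prop_em n) (by simp [lang, Formula.fv]))).resolve_right fun hn => ?_
  exact T'.consistent (.neg_elim (.hyp (hle.2 hn)) (.hyp h))

lemma update_mem_params {N k l : ℕ} {σ : ℕ → ℕ} (hσ : ∀ n, σ n ∈ params N k) (hkl : k ≤ l)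
    (x : ℕ) {d : ℕ} (hd : d ∈ params N l) (n : ℕ) : Function.update σ x d n ∈ params N l := by
  by_cases hn : n = x
  · simpa [hn] using hd
  · simpa [hn] using params_mono N hkl (hσ n)

/-- The truth lemma for the canonical Kripke structure. -/
lemma canonicalKripke_forces_iff {N : ℕ} (A : Formula) (hA : ∀ y ∈ A.bv, y < N)
    (T : PrimeTheory N) (σ : ℕ → ℕ) (hσ : ∀ n, σ n ∈ params N T.level) :
    (canonicalKripke N).forces T σ A ↔ A.subst σ ∈ T.carrier := by
  have hlang := subst_mem_lang hσ A
  induction A generalizing T σ with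
  | prop n => rfl
  | pred n x xs =>
    constructor
    · rintro ⟨_, _, h, hm⟩
      cases h
      exact hm
    · exact fun h => ⟨_, _, rfl, h⟩
  | top => exact iff_of_true trivial (T.closed .top_intro hlang)
  | bot => exact iff_of_false id fun h => T.consistent (.hyp h)
  | and A B ihA ihB =>
    simp only [Formula.bv, Finset.mem_union] at hA
    have hlA := subst_mem_lang hσ A
    have hlB := subst_mem_lang hσ B
    refine (and_congr (ihA (fun y hy => hA y (.inl hy)) T σ hσ hlA)
      (ihB (fun y hy => hA y (.inr hy)) T σ hσ hlB)).trans ⟨fun h => ?_, fun h => ⟨?_, ?_⟩⟩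
    · exact T.closed (.and_intro (.hyp h.1) (.hyp h.2)) hlang
    · exact T.closed (Prov.and_left (.hyp h)) hlA
    · exact T.closed (Prov.and_right (.hyp h)) hlB
  | or A B ihA ihB =>
    simp only [Formula.bv, Finset.mem_union] at hA
    refine (or_congr (ihA (fun y hy => hA y (.inl hy)) T σ hσ (subst_mem_lang hσ A))
      (ihB (fun y hy => hA y (.inr hy)) T σ hσ (subst_mem_lang hσ B))).trans
      ⟨fun h => T.closed ?_ hlang, T.prime⟩
    exact h.elim (fun h => .or_inl (.hyp h)) fun h => .or_inr (.hyp h)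
  | imp A B ihA ihB =>
    simp only [Formula.bv, Finset.mem_union] at hA
    have ihA' := ihA fun y hy => hA y (.inl hy)
    have ihB' := ihB fun y hy => hA y (.inr hy)
    constructor
    · intro h
      by_contra hn
      have hp : ¬ Prov (insert (A.subst σ) T.carrier) (B.subst σ) := fun hp =>
        hn (T.closed hp.imp_intro hlang)
      obtain ⟨T', hl, hsub, hB⟩ := exists_primeTheory
        (Set.insert_subset (subst_mem_lang hσ A) T.subset_lang) hp
      have hle : T.level ≤ T'.level := by omega
      have hσ' := fun n => params_mono N hle (hσ n)
      refine hB ((ihB' T' σ hσ' (subst_mem_lang hσ' B)).1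
        (h T' ⟨hle, (Set.subset_insert _ _).trans hsub⟩ ?_))
      exact (ihA' T' σ hσ' (subst_mem_lang hσ' A)).2 (hsub (Set.mem_insert _ _))
    · intro h (T' : PrimeTheory N) hle hfA
      have hσ' := fun n => params_mono N hle.1 (hσ n)
      have hmA := (ihA' T' σ hσ' (subst_mem_lang hσ' A)).1 hfA
      exact (ihB' T' σ hσ' (subst_mem_lang hσ' B)).2
        (T'.closed (.mp (.hyp (hle.2 h)) (.hyp hmA)) (subst_mem_lang hσ' B))
  | neg A ih =>
    have ih' := ih hA
    constructor
    · intro h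
      by_contra hn
      have hp : ¬ Prov (insert (A.subst σ) T.carrier) .bot := fun hp =>
        hn (T.closed hp.neg_intro hlang)
      obtain ⟨T', hl, hsub, -⟩ := exists_primeTheory
        (Set.insert_subset (subst_mem_lang hσ A) T.subset_lang) hp
      have hle : T.level ≤ T'.level := by omega
      have hσ' := fun n => params_mono N hle (hσ n)
      exact h T' ⟨hle, (Set.subset_insert _ _).trans hsub⟩
        ((ih' T' σ hσ' (subst_mem_lang hσ' A)).2 (hsub (Set.mem_insert _ _)))
    · intro h (T' : PrimeTheory N) hle hfA
      have hσ' := fun n => params_mono N hle.1 (hσ n)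
      have hmA := (ih' T' σ hσ' (subst_mem_lang hσ' A)).1 hfA
      exact T'.consistent (.neg_elim (.hyp (hle.2 h)) (.hyp hmA))
  | all x A ih =>
    simp only [Formula.bv, Finset.mem_insert, forall_eq_or_imp] at hA
    have hren := fun a => Formula.rename_subst A a fun z (_ : z ≠ x) =>
      (lt_of_lt_of_le hA.1 (hσ z).1).ne'
    have hbv : ∀ {k a}, a ∈ params N k → a ∉ (A.subst (Function.update σ x x)).bv :=
      fun ha h => absurd (hA.2 _ (Formula.bv_subst A _ ▸ h)) (not_lt.2 ha.1)
    constructor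
    · intro h
      by_contra hn
      obtain ⟨a, ha, hak, -⟩ := exists_fresh_param N T.level ∅
      have hvars : a ∉ (A.subst (Function.update σ x x)).vars := by
        rw [Formula.vars_eq, Finset.mem_union, not_or]
        refine ⟨fun hfv => hak (hlang a ?_), hbv ha⟩
        exact Finset.mem_erase.2 ⟨(lt_of_lt_of_le hA.1 ha.1).ne', hfv⟩
      have hp : ¬ Prov T.carrier (A.subst (Function.update σ x a)) := by
        rw [← hren a]
        exact fun hp => hn (T.closed
          (hp.all_intro (fun B hB haB => hak (T.subset_lang hB a haB)) hvars) hlang)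
      have hσa := update_mem_params hσ T.level.le_succ x ha
      obtain ⟨T', hl, hsub, hA'⟩ := exists_primeTheory T.subset_lang hp
      rw [Nat.succ_eq_add_one, ← hl] at hσa
      refine hA' ((ih hA.2 T' _ hσa (subst_mem_lang hσa A)).1 (h T' ⟨by omega, hsub⟩ a ?_))
      exact (hl ▸ ha : a ∈ params N T'.level)
    · intro h (T' : PrimeTheory N) hle d hd
      have hσd := update_mem_params hσ hle.1 x hd
      refine (ih hA.2 T' _ hσd (subst_mem_lang hσd A)).2
        (T'.closed ?_ (subst_mem_lang hσd A))
      rw [← hren d]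
      exact .all_elim (hbv hd) (.hyp (hle.2 h))
  | ex x A ih =>
    simp only [Formula.bv, Finset.mem_insert, forall_eq_or_imp] at hA
    have hren := fun a => Formula.rename_subst A a fun z (_ : z ≠ x) =>
      (lt_of_lt_of_le hA.1 (hσ z).1).ne'
    constructor
    · rintro ⟨d, hd, hf⟩
      have hσd := update_mem_params hσ le_rfl x hd
      refine T.closed (.ex_intro (a := d) (fun h => ?_) (.hyp ?_)) hlang
      · exact absurd (hA.2 _ (Formula.bv_subst A _ ▸ h)) (not_lt.2 hd.1)
      · rw [hren d]
        exact (ih hA.2 T _ hσd (subst_mem_lang hσd A)).1 hf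
    · intro h
      obtain ⟨a, ha, hm⟩ := T.witness h
      have hσa := update_mem_params hσ le_rfl x ha
      rw [hren a] at hm
      exact ⟨a, ha, (ih hA.2 T _ hσa (subst_mem_lang hσa A)).2 hm⟩

/-- A formula is derivable if it is derivable after shifting variables beyond a bound on its
variables. -/
lemma LJPlus.of_subst_add {F : Formula} {N : ℕ} (hN : ∀ y ∈ F.vars, y < N) {s : Finset ℕ}
    (hs : ∀ x ∈ s, x < N)
    (d : LJPlus ([], some (F.subst fun n => if n ∈ s then n + N else n))) :
    LJPlus ([], some F) := by
  rw [Formula.vars_eq] at hN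
  induction s using Finset.induction_on with
  | empty => simpa [← Function.id_def, Formula.subst_id] using d
  | insert x s hx ih =>
    have hxN : x < N := hs x (by simp)
    have hs' : ∀ z ∈ s, z < N := fun z hz => hs z (by simp [hz])
    refine ih hs' (LJPlus.of_rename (x := x) (a := x + N) (fun ha => ?_) ?_)
    · rw [Formula.vars_eq, Formula.bv_subst, Finset.mem_union] at ha
      rcases ha with ha | ha
      · obtain ⟨z, hz, e⟩ := Formula.mem_fv_subst ha
        have := hN z (Finset.mem_union_left _ hz)
        split_ifs at e with hzs
        · exact hx (by rwa [← Nat.add_right_cancel e])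
        · omega
      · have := hN _ (Finset.mem_union_right _ ha)
        omega
    · have hself : Function.update (fun n => if n ∈ s then n + N else n) x x =
          fun n => if n ∈ s then n + N else n := Function.update_eq_iff.2 ⟨by simp [hx], by simp⟩
      have hren := Formula.rename_subst F (σ := fun n => if n ∈ s then n + N else n) (x := x)
        (x + N) fun z hz => by split_ifs <;> omega
      rw [hself] at hren
      rw [hren]
      convert d using 4
      ext n
      by_cases hn : n = x <;> simp [hn]

/-- completeness of LJ+ with respect to constrained Kripke
structures: if F is forced at every node of every constrained Kripke structure,
then F is derivable in LJ+. -/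
theorem ljplus_complete_constrained_kripke (F : Formula)
    (h : ∀ K : Kripke, K.Constrained → ∀ (w : K.W) (σ : ℕ → K.U),
      (∀ n, σ n ∈ K.D w) → K.forces w σ F) :
    LJPlusThm F := by
  let N := F.vars.sup id + 1
  have hN : ∀ y ∈ F.vars, y < N := fun y hy => Nat.lt_succ_of_le (Finset.le_sup (f := id) hy)
  refine LJPlus.of_subst_add hN (s := Finset.range N) (by simp) ?_
  have hσ : ∀ n, min n N + N ∈ params N (2 * N) := fun n =>
    ⟨by omega, (Nat.unpair_left_le _).trans (by omega)⟩
  rw [Formula.subst_congr (τ := fun n => min n N + N) fun x hx => ?_]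
  · by_contra hn
    have hp : ¬ Prov ∅ (F.subst fun n => min n N + N) := by
      rintro ⟨Γ, hΓ, d⟩
      rw [List.eq_nil_iff_forall_not_mem.2 hΓ] at d
      exact hn d
    obtain ⟨T, hl, -, hT⟩ := exists_primeTheory (N := N) (k := 2 * N) (Set.empty_subset _) hp
    have hσT : ∀ n, min n N + N ∈ params N T.level := fun n =>
      params_mono N (by omega) (hσ n)
    refine hT ((canonicalKripke_forces_iff F (fun y hy => hN y ?_) T _ hσT).1
      (h _ (canonicalKripke_constrained N) T _ hσT))
    exact Formula.vars_eq F ▸ Finset.mem_union_right _ hy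
  · have hxN : x < N := hN x (Formula.vars_eq F ▸ Finset.mem_union_left _ hx)
    simp [hxN, hxN.le]
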